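/- arXiv:2205.04198 — 4 statements merged into one kernel-verified Lean document; each statement's English description precedes it below -/
import Mathlib

section
/- For two model modifications m1 = (M_c ← K_i → M_i) and m2 = (M_c ← K_j → M_j) with common source M_c and a well-formedness constraint φ with violation pattern Q, the set of matches pcheck(merge_G^min(m1, m2), φ) equals the intersection ⋂_{str ∈ S} pcheck(merge_G^str(m1, m2), φ), where S is the set of all valid conflict resolution strategies. -/
/-! ## Common framework

Graph elements are drawn from global universes `N` (nodes) and `E` (edges)
with globally fixed incidence functions `src`, `tgt` (element identity across
graphs; sources and targets are invariant).  A graph is a pair of subsets. -/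

/-- A graph given by its sets of node- and edge-identifiers. -/
structure PreGraph (N : Type) (E : Type) where
  verts : Set N
  edges : Set E

/-- `G` is a proper graph w.r.t. the global incidence functions. -/
def IsGraph {N E : Type} (src tgt : E → N) (G : PreGraph N E) : Prop :=
  (∀ e ∈ G.edges, src e ∈ G.verts) ∧ (∀ e ∈ G.edges, tgt e ∈ G.verts)

/-- Membership of an element (node or edge) in a graph. -/
def memEl {N E : Type} (x : N ⊕ E) (G : PreGraph N E) : Prop :=
  Sum.elim (· ∈ G.verts) (· ∈ G.edges) x

/-- A model modification `(base ← mid → res)`; the two morphisms are partial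
identities, i.e. set inclusions (see `Modif.Proper`). -/
structure Modif (N : Type) (E : Type) where
  base : PreGraph N E
  mid : PreGraph N E
  res : PreGraph N E

/-- The span consists of proper graphs and the morphisms are inclusions. -/
def Modif.Proper {N E : Type} (src tgt : E → N) (m : Modif N E) : Prop :=
  IsGraph src tgt m.base ∧ IsGraph src tgt m.mid ∧ IsGraph src tgt m.res ∧
  m.mid.verts ⊆ m.base.verts ∧ m.mid.edges ⊆ m.base.edges ∧
  m.mid.verts ⊆ m.res.verts ∧ m.mid.edges ⊆ m.res.edges

/-- A modification is maximally preserving iff `K = G ∩ H`. -/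
def Modif.MaxPreserving {N E : Type} (m : Modif N E) : Prop :=
  m.mid.verts = m.base.verts ∩ m.res.verts ∧ m.mid.edges = m.base.edges ∩ m.res.edges

def Modif.deletedV {N E : Type} (m : Modif N E) : Set N := m.base.verts \ m.mid.verts
def Modif.createdV {N E : Type} (m : Modif N E) : Set N := m.res.verts \ m.mid.verts
def Modif.deletedE {N E : Type} (m : Modif N E) : Set E := m.base.edges \ m.mid.edges
def Modif.createdE {N E : Type} (m : Modif N E) : Set E := m.res.edges \ m.mid.edges

/-- `mcheck m1 m2`: all insert-delete conflicts `(e, v)` between two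
modifications with common source: one modification creates the edge `e`
whose source or target node `v` is deleted by the other modification. -/
def mcheck {N E : Type} (src tgt : E → N) (m1 m2 : Modif N E) : Set (E × N) :=
  {p | (src p.1 = p.2 ∨ tgt p.1 = p.2) ∧
    ((p.1 ∈ m1.createdE ∧ p.2 ∈ m2.deletedV) ∨
     (p.1 ∈ m2.createdE ∧ p.2 ∈ m1.deletedV))}

/-- Three-way merge equipped with a conflict resolution strategy `str`:
for each insert-delete conflict, `str = true` means the node deletion is
reverted, `str = false` means the edge creation is reverted.  The merged graph
contains the elements preserved by both modifications and the elements created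
by either modification, as altered by the strategy's resolutions. -/
def mergeGr {N E : Type} (src tgt : E → N) (m1 m2 : Modif N E)
    (str : E × N → Bool) : PreGraph N E where
  verts := (m1.mid.verts ∩ m2.mid.verts) ∪ m1.createdV ∪ m2.createdV ∪
    {v | ∃ e, (e, v) ∈ mcheck src tgt m1 m2 ∧ str (e, v) = true}
  edges := (m1.mid.edges ∩ m2.mid.edges) ∪
    {e | e ∈ m1.createdE ∪ m2.createdE ∧
      ∀ v, (e, v) ∈ mcheck src tgt m1 m2 → str (e, v) = true}

/-- A strategy is valid iff it always produces a proper merged graph. -/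
def ValidStrategy {N E : Type} (src tgt : E → N) (m1 m2 : Modif N E)
    (str : E × N → Bool) : Prop :=
  IsGraph src tgt (mergeGr src tgt m1 m2 str)

/-- The deletion-favouring merge `merge_G^min`: preserved elements together
with created elements, excluding every created edge whose source or target
node is deleted by the other modification. -/
def mergeMin {N E : Type} (src tgt : E → N) (m1 m2 : Modif N E) : PreGraph N E :=
  mergeGr src tgt m1 m2 (fun _ => false)

/-! ## Patterns and matches -/

/-- A violation pattern: a graph typed over the type graph `(TN, TE)`. -/
structure Pattern (TN : Type) (TE : Type) where
  NQ : Type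
  EQ : Type
  srcQ : EQ → NQ
  tgtQ : EQ → NQ
  tyV : NQ → TN
  tyE : EQ → TE

/-- A match: a typed graph monomorphism from the pattern `Q` into `X`
(elements of `X` are typed by the global typing `tyN`, `tyEg`). -/
structure IsMatch {N E TN TE : Type} (src tgt : E → N) (tyN : N → TN)
    (tyEg : E → TE) (Q : Pattern TN TE) (X : PreGraph N E)
    (fv : Q.NQ → N) (fe : Q.EQ → E) : Prop where
  inj_v : Function.Injective fv
  inj_e : Function.Injective fe
  comm_src : ∀ e, src (fe e) = fv (Q.srcQ e)
  comm_tgt : ∀ e, tgt (fe e) = fv (Q.tgtQ e)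
  ty_v : ∀ v, tyN (fv v) = Q.tyV v
  ty_e : ∀ e, tyEg (fe e) = Q.tyE e
  mem_v : ∀ v, fv v ∈ X.verts
  mem_e : ∀ e, fe e ∈ X.edges

/-- `pcheck X φ`: the set of all matches of the violation pattern into `X`. -/
def pcheck {N E TN TE : Type} (src tgt : E → N) (tyN : N → TN) (tyEg : E → TE)
    (Q : Pattern TN TE) (X : PreGraph N E) : Set ((Q.NQ → N) × (Q.EQ → E)) :=
  {m | IsMatch src tgt tyN tyEg Q X m.1 m.2}

/-! ## Correct model versionings -/

/-- A correct model versioning: models `M i`, modification relation `delta`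
(each modification is the maximally preserving one, with partial-identity
morphisms, between its endpoints — it is determined by the two endpoints),
an acyclic predecessor relation, and an initial model `root`. -/
structure Versioning (N : Type) (E : Type) (src tgt : E → N) (ι : Type) where
  M : ι → PreGraph N E
  isGraph : ∀ i, IsGraph src tgt (M i)
  delta : ι → ι → Prop
  acyclic : ∀ i, ¬ Relation.TransGen delta i i
  root : ι
  root_pre : ∀ i, i ≠ root → Relation.TransGen delta root i

namespace Versioning

variable {N E ι : Type} {src tgt : E → N}

/-- `pre a b`: `a` is a predecessor of `b`. -/
def pre (V : Versioning N E src tgt ι) (a b : ι) : Prop :=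
  Relation.TransGen V.delta a b

/-- The union `P^M` of all model versions. -/
def unionPG (V : Versioning N E src tgt ι) : PreGraph N E :=
  ⟨⋃ i, (V.M i).verts, ⋃ i, (V.M i).edges⟩

/-- `cv` edges of the multi-version model: element `x` has a `cv` edge to
version `j` iff some modification into `M j` creates `x`, or `j` is the
initial version and `x ∈ M root`. -/
def cvR (V : Versioning N E src tgt ι) (x : N ⊕ E) (j : ι) : Prop :=
  (∃ i, V.delta i j ∧ ¬ memEl x (V.M i) ∧ memEl x (V.M j)) ∨
  (j = V.root ∧ memEl x (V.M V.root))

/-- `dv` edges: element `x` has a `dv` edge to version `j` iff some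
modification into `M j` deletes `x`. -/
def dvR (V : Versioning N E src tgt ι) (x : N ⊕ E) (j : ι) : Prop :=
  ∃ i, V.delta i j ∧ memEl x (V.M i) ∧ ¬ memEl x (V.M j)

/-- mv-presence: `x` is mv-present in version `i` iff there is a version `j`
with a `cv` edge from `x` and a path of `suc` edges from `j` to `i` that does
not pass through any version with a `dv` edge from `x`. -/
def mvPresent (V : Versioning N E src tgt ι) (x : N ⊕ E) (i : ι) : Prop :=
  ∃ j, V.cvR x j ∧ ¬ V.dvR x j ∧
    Relation.ReflTransGen (fun a b => V.delta a b ∧ ¬ V.dvR x b) j i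

/-- `p x`: the set of versions in which `x` is mv-present. -/
def pSet (V : Versioning N E src tgt ι) (x : N ⊕ E) : Set ι :=
  {i | V.mvPresent x i}

/-- The projection `proj(MVM, i)`. -/
def projPG (V : Versioning N E src tgt ι) (i : ι) : PreGraph N E :=
  ⟨{v | V.mvPresent (Sum.inl v) i}, {e | V.mvPresent (Sum.inr e) i}⟩

/-- `proj^Δ(MVM, c, i)`: the maximally preserving model modification from
`proj(MVM, c)` to `proj(MVM, i)`. -/
def projModif (V : Versioning N E src tgt ι) (c i : ι) : Modif N E :=
  ⟨V.projPG c,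
   ⟨(V.projPG c).verts ∩ (V.projPG i).verts,
    (V.projPG c).edges ∩ (V.projPG i).edges⟩,
   V.projPG i⟩

/-- `pre^C i j`: the set of latest common predecessors (empty if one of the
two versions is a predecessor of the other). -/
def preC (V : Versioning N E src tgt ι) (i j : ι) : Set ι :=
  {c | ¬ V.pre i j ∧ ¬ V.pre j i ∧ V.pre c i ∧ V.pre c j ∧
       ∀ x, V.pre x i → V.pre x j → ¬ V.pre c x}

end Versioning

/-! ## The multi-version model as a typed graph -/

/-- A typed graph (over the node-type universe `TN` and edge-type universe
`TE` of its type graph). -/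
structure TypedGraph (TN : Type) (TE : Type) where
  V : Type
  Ed : Type
  Vset : Set V
  Eset : Set Ed
  s : Ed → V
  t : Ed → V
  tyV : V → TN
  tyE : Ed → TE

/-- Node types of the adapted type graph `TM_mv`: a node `corr_mv x` for each
node and each edge `x` of `TM`, plus the node `version`. -/
abbrev TNmv (TN TE : Type) : Type := (TN ⊕ TE) ⊕ Unit

/-- Edge types of `TM_mv`: `corr^s`, `corr^t`, `suc`, `cv`, `dv`. -/
abbrev TEmv (TN TE : Type) : Type :=
  (TE ⊕ TE) ⊕ (Unit ⊕ ((TN ⊕ TE) ⊕ (TN ⊕ TE)))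

/-- Nodes of the multi-version model: one node per element of `P^M`
(the `origin` bijection is the identity on `N ⊕ E`) and one node per version. -/
abbrev MVNode (N E ι : Type) : Type := (N ⊕ E) ⊕ ι

/-- Edges of the multi-version model: source- and target-encoding edges,
`suc` edges, `cv` edges and `dv` edges. -/
abbrev MVEdge (N E ι : Type) : Type :=
  (E ⊕ E) ⊕ ((ι × ι) ⊕ (((N ⊕ E) × ι) ⊕ ((N ⊕ E) × ι)))

/-- A typed graph monomorphism. -/
def IsTypedMono {TN TE : Type} (A B : TypedGraph TN TE)
    (fv : A.V → B.V) (fe : A.Ed → B.Ed) : Prop :=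
  Function.Injective fv ∧ Function.Injective fe ∧
  (∀ v ∈ A.Vset, fv v ∈ B.Vset) ∧ (∀ e ∈ A.Eset, fe e ∈ B.Eset) ∧
  (∀ e, B.s (fe e) = fv (A.s e)) ∧ (∀ e, B.t (fe e) = fv (A.t e)) ∧
  (∀ v, B.tyV (fv v) = A.tyV v) ∧ (∀ e, B.tyE (fe e) = A.tyE e)

/-- `trans_mv Q`: the translation of a pattern `Q` (typed over `TM`) to a
typed graph over `TM_mv`; `origin_Q` is the identity. -/
def Pattern.transMV {TN TE : Type} (Q : Pattern TN TE) :
    TypedGraph (TNmv TN TE) (TEmv TN TE) where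
  V := Q.NQ ⊕ Q.EQ
  Ed := Q.EQ ⊕ Q.EQ
  Vset := Set.univ
  Eset := Set.univ
  s := Sum.elim (fun e => Sum.inr e) (fun e => Sum.inr e)
  t := Sum.elim (fun e => Sum.inl (Q.srcQ e)) (fun e => Sum.inl (Q.tgtQ e))
  tyV := Sum.elim (fun v => Sum.inl (Sum.inl (Q.tyV v)))
    (fun e => Sum.inl (Sum.inr (Q.tyE e)))
  tyE := Sum.elim (fun e => Sum.inl (Sum.inl (Q.tyE e)))
    (fun e => Sum.inl (Sum.inr (Q.tyE e)))

/-- `comb Δ`: the multi-version model of a correct model versioning, as a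
typed graph over the adapted type graph (global element typing `tyN`, `tyEg`). -/
def Versioning.comb {N E ι TN TE : Type} {src tgt : E → N}
    (V : Versioning N E src tgt ι) (tyN : N → TN) (tyEg : E → TE) :
    TypedGraph (TNmv TN TE) (TEmv TN TE) where
  V := MVNode N E ι
  Ed := MVEdge N E ι
  Vset := {w | match w with
    | Sum.inl (Sum.inl v) => v ∈ V.unionPG.verts
    | Sum.inl (Sum.inr e) => e ∈ V.unionPG.edges
    | Sum.inr _ => True}
  Eset := {w | match w with
    | Sum.inl (Sum.inl e) => e ∈ V.unionPG.edges
    | Sum.inl (Sum.inr e) => e ∈ V.unionPG.edges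
    | Sum.inr (Sum.inl (i, j)) => V.delta i j
    | Sum.inr (Sum.inr (Sum.inl (x, j))) => V.cvR x j
    | Sum.inr (Sum.inr (Sum.inr (x, j))) => V.dvR x j}
  s := fun w => match w with
    | Sum.inl (Sum.inl e) => Sum.inl (Sum.inr e)
    | Sum.inl (Sum.inr e) => Sum.inl (Sum.inr e)
    | Sum.inr (Sum.inl (i, _)) => Sum.inr i
    | Sum.inr (Sum.inr (Sum.inl (x, _))) => Sum.inl x
    | Sum.inr (Sum.inr (Sum.inr (x, _))) => Sum.inl x
  t := fun w => match w with
    | Sum.inl (Sum.inl e) => Sum.inl (Sum.inl (src e))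
    | Sum.inl (Sum.inr e) => Sum.inl (Sum.inl (tgt e))
    | Sum.inr (Sum.inl (_, j)) => Sum.inr j
    | Sum.inr (Sum.inr (Sum.inl (_, j))) => Sum.inr j
    | Sum.inr (Sum.inr (Sum.inr (_, j))) => Sum.inr j
  tyV := fun w => match w with
    | Sum.inl (Sum.inl v) => Sum.inl (Sum.inl (tyN v))
    | Sum.inl (Sum.inr e) => Sum.inl (Sum.inr (tyEg e))
    | Sum.inr _ => Sum.inr ()
  tyE := fun w => match w with
    | Sum.inl (Sum.inl e) => Sum.inl (Sum.inl (tyEg e))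
    | Sum.inl (Sum.inr e) => Sum.inl (Sum.inr (tyEg e))
    | Sum.inr (Sum.inl _) => Sum.inr (Sum.inl ())
    | Sum.inr (Sum.inr (Sum.inl (x, _))) =>
        Sum.inr (Sum.inr (Sum.inl (Sum.elim (fun v => Sum.inl (tyN v))
          (fun e => Sum.inr (tyEg e)) x)))
    | Sum.inr (Sum.inr (Sum.inr (x, _))) =>
        Sum.inr (Sum.inr (Sum.inr (Sum.elim (fun v => Sum.inl (tyN v))
          (fun e => Sum.inr (tyEg e)) x)))

/-- `Corr Q fv m` states `m = origin ∘ m_mv ∘ origin_Q⁻¹` for the node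
function `fv` of a morphism `m_mv : trans_mv Q → MVM`. -/
def Corr {N E TN TE ι : Type} (Q : Pattern TN TE)
    (fv : (Q.NQ ⊕ Q.EQ) → MVNode N E ι)
    (m : (Q.NQ → N) × (Q.EQ → E)) : Prop :=
  (∀ v, fv (Sum.inl v) = Sum.inl (Sum.inl (m.1 v))) ∧
  (∀ e, fv (Sum.inr e) = Sum.inl (Sum.inr (m.2 e)))

/-- mv-presence set of a node of the multi-version model (element-representing
nodes only; version nodes get `∅`). -/
def Versioning.pOf {N E ι : Type} {src tgt : E → N}
    (V : Versioning N E src tgt ι) (w : MVNode N E ι) : Set ι :=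
  match w with
  | Sum.inl x => V.pSet x
  | Sum.inr _ => ∅

/-- `pcheck_mv(MVM, φ)`: all matches `m_mv` of `trans_mv Q` into `MVM` are
found; for each, `P = ⋂_{v} p (m_mv v)` is computed and, if `P ≠ ∅`, the
corresponding match `m = origin ∘ m_mv ∘ origin_Q⁻¹` is reported as a
violation in every version of `P`. -/
def pcheckMV {N E TN TE ι : Type} (src tgt : E → N) (tyN : N → TN)
    (tyEg : E → TE) (V : Versioning N E src tgt ι) (Q : Pattern TN TE) :
    Set (ι × ((Q.NQ → N) × (Q.EQ → E))) :=
  {p | ∃ (fv : (Q.NQ ⊕ Q.EQ) → MVNode N E ι) (fe : (Q.EQ ⊕ Q.EQ) → MVEdge N E ι),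
    IsTypedMono Q.transMV (V.comb tyN tyEg) fv fe ∧
    Corr Q fv p.2 ∧
    ∀ v : Q.NQ ⊕ Q.EQ, p.1 ∈ V.pOf (fv v)}

/-- `mcheck_mv(MVM)`: all insert-delete conflicts of all possible merges,
computed on the multi-version model and reported in normalized form. -/
def mcheckMV {N E ι : Type} [LinearOrder ι] (src tgt : E → N)
    (V : Versioning N E src tgt ι) : Set (ι × ι × ι × (E × N)) :=
  {q | ∃ e v i j c, q = (min i j, max i j, c, (e, v)) ∧
    (v = src e ∨ v = tgt e) ∧
    (∃ j', V.cvR (Sum.inr e) j' ∧ j' ≠ V.root) ∧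
    V.pSet (Sum.inr e) ≠ V.pSet (Sum.inl v) ∧
    i ∈ V.pSet (Sum.inr e) ∧
    (∃ k, V.dvR (Sum.inl v) k ∧ ¬ V.cvR (Sum.inl v) k ∧
      Relation.ReflTransGen (fun a b => V.delta a b ∧ ¬ V.cvR (Sum.inl v) b) k j) ∧
    c ∈ V.preC i j ∧ c ∈ V.pSet (Sum.inl v) ∧ c ∉ V.pSet (Sum.inr e)}

/-- `pcheck^m_mv(MVM, φ)`: for each match `m_mv` of `trans_mv Q` into `MVM`
with corresponding match `m`, each pair of versions `i`, `j` such that every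
node in the image of `m_mv` is mv-present in `i` or in `j`, and each latest
common predecessor `c ∈ pre^C(i, j)` such that every element matched by `m`
that lies in `M c` lies in both `M i` and `M j`, the normalized tuple
`(min i j, max i j, c, m)` is reported. -/
def pcheckMergeMV {N E TN TE ι : Type} [LinearOrder ι] (src tgt : E → N)
    (tyN : N → TN) (tyEg : E → TE) (V : Versioning N E src tgt ι)
    (Q : Pattern TN TE) :
    Set (ι × ι × ι × ((Q.NQ → N) × (Q.EQ → E))) :=
  {q | ∃ i j c m, q = (min i j, max i j, c, m) ∧
    ∃ (fv : (Q.NQ ⊕ Q.EQ) → MVNode N E ι) (fe : (Q.EQ ⊕ Q.EQ) → MVEdge N E ι),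
      IsTypedMono Q.transMV (V.comb tyN tyEg) fv fe ∧
      Corr Q fv m ∧
      (∀ v : Q.NQ ⊕ Q.EQ, i ∈ V.pOf (fv v) ∨ j ∈ V.pOf (fv v)) ∧
      c ∈ V.preC i j ∧
      (∀ v : Q.NQ, m.1 v ∈ (V.M c).verts →
        m.1 v ∈ (V.M i).verts ∧ m.1 v ∈ (V.M j).verts) ∧
      (∀ e : Q.EQ, m.2 e ∈ (V.M c).edges →
        m.2 e ∈ (V.M i).edges ∧ m.2 e ∈ (V.M j).edges)}

theorem mergeMin_verts_subset {N E : Type} (src tgt : E → N) (m1 m2 : Modif N E)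
    (str : E × N → Bool) :
    (mergeMin src tgt m1 m2).verts ⊆ (mergeGr src tgt m1 m2 str).verts := by
  rintro v (hv | ⟨e, -, h⟩)
  · exact Or.inl hv
  · exact absurd h Bool.false_ne_true

theorem mergeMin_edges_subset {N E : Type} (src tgt : E → N) (m1 m2 : Modif N E)
    (str : E × N → Bool) :
    (mergeMin src tgt m1 m2).edges ⊆ (mergeGr src tgt m1 m2 str).edges := by
  rintro e (he | ⟨he, hfree⟩)
  · exact Or.inl he
  · exact Or.inr ⟨he, fun v hv => absurd (hfree v hv) Bool.false_ne_true⟩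

/-- An endpoint of an edge of the deletion-favouring merge belongs to that merge. -/
theorem mem_mergeMin_verts_of_incident {N E : Type} {src tgt : E → N} {m1 m2 : Modif N E}
    (h1 : m1.Proper src tgt) (h2 : m2.Proper src tgt) (hcommon : m1.base = m2.base)
    {e : E} {v : N} (hv : src e = v ∨ tgt e = v)
    (he : e ∈ (mergeMin src tgt m1 m2).edges) :
    v ∈ (mergeMin src tgt m1 m2).verts := by
  have incident : ∀ {G : PreGraph N E}, IsGraph src tgt G → e ∈ G.edges → v ∈ G.verts := by
    intro G hG heG
    rcases hv with rfl | rfl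
    exacts [hG.1 e heG, hG.2 e heG]
  obtain ⟨-, hmid1, hres1, hsub1, -⟩ := h1
  obtain ⟨-, hmid2, hres2, hsub2, -⟩ := h2
  left
  rcases he with ⟨he1, he2⟩ | ⟨he | he, hfree⟩
  · exact Or.inl (Or.inl ⟨incident hmid1 he1, incident hmid2 he2⟩)
  · by_cases hv1 : v ∈ m1.mid.verts
    · by_cases hv2 : v ∈ m2.mid.verts
      · exact Or.inl (Or.inl ⟨hv1, hv2⟩)
      · exact absurd (hfree v ⟨hv, Or.inl ⟨he, hcommon ▸ hsub1 hv1, hv2⟩⟩) Bool.false_ne_true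
    · exact Or.inl (Or.inr ⟨incident hres1 he.1, hv1⟩)
  · by_cases hv2 : v ∈ m2.mid.verts
    · by_cases hv1 : v ∈ m1.mid.verts
      · exact Or.inl (Or.inl ⟨hv1, hv2⟩)
      · exact absurd (hfree v ⟨hv, Or.inr ⟨he, hcommon ▸ hsub2 hv2, hv1⟩⟩) Bool.false_ne_true
    · exact Or.inr ⟨incident hres2 he.1, hv2⟩

theorem validStrategy_false {N E : Type} {src tgt : E → N} {m1 m2 : Modif N E}
    (h1 : m1.Proper src tgt) (h2 : m2.Proper src tgt) (hcommon : m1.base = m2.base) :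
    ValidStrategy src tgt m1 m2 (fun _ => false) :=
  ⟨fun _ he => mem_mergeMin_verts_of_incident h1 h2 hcommon (Or.inl rfl) he,
    fun _ he => mem_mergeMin_verts_of_incident h1 h2 hcommon (Or.inr rfl) he⟩

theorem pcheck_mono {N E TN TE : Type} (src tgt : E → N) (tyN : N → TN) (tyEg : E → TE)
    (Q : Pattern TN TE) {X Y : PreGraph N E} (hV : X.verts ⊆ Y.verts)
    (hE : X.edges ⊆ Y.edges) :
    pcheck src tgt tyN tyEg Q X ⊆ pcheck src tgt tyN tyEg Q Y :=
  fun _ hm => { hm with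
    mem_v := fun v => hV (hm.mem_v v)
    mem_e := fun e => hE (hm.mem_e e) }

/-- For two model modifications `m1 = (M_c ← K_i → M_i)` and
`m2 = (M_c ← K_j → M_j)` with common source `M_c` and a well-formedness
constraint `φ` with violation pattern `Q`,
`pcheck (merge_G^min (m1, m2)) φ = ⋂_{str ∈ S} pcheck (merge_G^str (m1, m2)) φ`,
where `S` is the set of all valid conflict resolution strategies. -/
theorem pcheck_mergeMin_eq_iInter_valid_strategies
    {N E TN TE : Type} (src tgt : E → N) (tyN : N → TN) (tyEg : E → TE)
    (m1 m2 : Modif N E)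
    (h1 : m1.Proper src tgt) (h2 : m2.Proper src tgt)
    (hcommon : m1.base = m2.base)
    (Q : Pattern TN TE) :
    pcheck src tgt tyN tyEg Q (mergeMin src tgt m1 m2) =
      ⋂ (str : E × N → Bool) (_ : ValidStrategy src tgt m1 m2 str),
        pcheck src tgt tyN tyEg Q (mergeGr src tgt m1 m2 str) := by
  apply Set.Subset.antisymm
  · exact Set.subset_iInter₂ fun str _ => pcheck_mono src tgt tyN tyEg Q
      (mergeMin_verts_subset src tgt m1 m2 str) (mergeMin_edges_subset src tgt m1 m2 str)
  · exact Set.iInter₂_subset _ (validStrategy_false h1 h2 hcommon)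
end

section
/- For a correct model versioning Δ over models M_1, …, M_n, the projection operation inverts the combination operation: for every i ∈ {1, …, n}, proj(comb(Δ), i) = M_i. -/
namespace Versioning

theorem memEl_of_cvR {N E ι : Type} {src tgt : E → N} {V : Versioning N E src tgt ι}
    {x : N ⊕ E} {j : ι} (h : V.cvR x j) : memEl x (V.M j) := by
  rcases h with ⟨_, _, _, hj⟩ | ⟨rfl, hj⟩ <;> exact hj

theorem not_dvR_of_memEl {N E ι : Type} {src tgt : E → N} {V : Versioning N E src tgt ι}
    {x : N ⊕ E} {j : ι} (h : memEl x (V.M j)) : ¬ V.dvR x j :=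
  fun ⟨_, _, _, hj⟩ => hj h

theorem mvPresent_of_cvR {N E ι : Type} {src tgt : E → N} {V : Versioning N E src tgt ι}
    {x : N ⊕ E} {j : ι} (h : V.cvR x j) : V.mvPresent x j :=
  ⟨j, h, not_dvR_of_memEl (memEl_of_cvR h), .refl⟩

theorem memEl_of_mvPresent {N E ι : Type} {src tgt : E → N} {V : Versioning N E src tgt ι}
    {x : N ⊕ E} {i : ι} (h : V.mvPresent x i) : memEl x (V.M i) := by
  obtain ⟨j, hcv, -, hpath⟩ := h
  induction hpath with
  | refl => exact memEl_of_cvR hcv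
  | tail _ hstep ih =>
    by_contra hx
    exact hstep.2 ⟨_, hstep.1, ih, hx⟩

theorem reflTransGen_root {N E ι : Type} {src tgt : E → N} (V : Versioning N E src tgt ι)
    (i : ι) : Relation.ReflTransGen V.delta V.root i := by
  by_cases hi : i = V.root
  · exact hi ▸ .refl
  · exact (V.root_pre i hi).to_reflTransGen

theorem mvPresent_of_memEl {N E ι : Type} {src tgt : E → N} {V : Versioning N E src tgt ι}
    {x : N ⊕ E} {i : ι} (h : memEl x (V.M i)) : V.mvPresent x i := by
  have hpath := V.reflTransGen_root i
  induction hpath with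
  | refl => exact mvPresent_of_cvR (.inr ⟨rfl, h⟩)
  | @tail a b _ hab ih =>
    by_cases ha : memEl x (V.M a)
    · obtain ⟨j, hcv, hdv, hj⟩ := ih ha
      exact ⟨j, hcv, hdv, hj.tail ⟨hab, not_dvR_of_memEl h⟩⟩
    · exact mvPresent_of_cvR (.inl ⟨a, hab, ha, h⟩)

theorem mvPresent_iff_memEl {N E ι : Type} {src tgt : E → N} (V : Versioning N E src tgt ι)
    (x : N ⊕ E) (i : ι) : V.mvPresent x i ↔ memEl x (V.M i) :=
  ⟨memEl_of_mvPresent, mvPresent_of_memEl⟩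

end Versioning

/-- For a correct model versioning `Δ` over models
`M_1, …, M_n`, projection inverts combination: for every version `i`,
`proj (comb Δ) i = M i`. -/
theorem proj_comb_eq
    {N E ι : Type} (src tgt : E → N) (V : Versioning N E src tgt ι) :
    ∀ i : ι, V.projPG i = V.M i := by
  intro i
  simp only [Versioning.projPG, Versioning.mvPresent_iff_memEl]
  rfl
end

section
/- For a well-formedness constraint φ with violation pattern Q, a correct model versioning Δ over models M_1, …, M_n, and MVM = comb(Δ), the multi-version check computes exactly the violations of all individual versions: pcheck_mv(MVM, φ) = ⨄_{i ∈ {1,…,n}} {(i, m) | m ∈ pcheck(proj(MVM, i), φ)}. -/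
theorem Versioning.cvR.memEl {N E ι : Type} {src tgt : E → N}
    {V : Versioning N E src tgt ι} {x : N ⊕ E} {j : ι} (h : V.cvR x j) :
    memEl x (V.M j) := by
  rcases h with ⟨_, _, _, h⟩ | ⟨rfl, h⟩ <;> exact h

theorem Versioning.mvPresent.exists_memEl {N E ι : Type} {src tgt : E → N}
    {V : Versioning N E src tgt ι} {x : N ⊕ E} {i : ι} (h : V.mvPresent x i) :
    ∃ j, memEl x (V.M j) :=
  let ⟨j, hj, _⟩ := h
  ⟨j, hj.memEl⟩

section MatchTranslation

variable {N E ι TN TE : Type} {src tgt : E → N} (V : Versioning N E src tgt ι)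
  {tyN : N → TN} {tyEg : E → TE}

/-- An edge of the multi-version model of type `corr^s` encodes the source of the
edge represented by its own source node. -/
theorem Versioning.comb_edge_src {w : MVEdge N E ι} {τ : TE} {e : E} {n : N}
    (hty : (V.comb tyN tyEg).tyE w = Sum.inl (Sum.inl τ))
    (hs : (V.comb tyN tyEg).s w = Sum.inl (Sum.inr e))
    (ht : (V.comb tyN tyEg).t w = Sum.inl (Sum.inl n)) : src e = n := by
  rcases w with (a | a) | (a | (a | a)) <;> simp_all [Versioning.comb]

/-- An edge of the multi-version model of type `corr^t` encodes the target of the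
edge represented by its own source node. -/
theorem Versioning.comb_edge_tgt {w : MVEdge N E ι} {τ : TE} {e : E} {n : N}
    (hty : (V.comb tyN tyEg).tyE w = Sum.inl (Sum.inr τ))
    (hs : (V.comb tyN tyEg).s w = Sum.inl (Sum.inr e))
    (ht : (V.comb tyN tyEg).t w = Sum.inl (Sum.inl n)) : tgt e = n := by
  rcases w with (a | a) | (a | (a | a)) <;> simp_all [Versioning.comb]

variable {V} {Q : Pattern TN TE} {m : (Q.NQ → N) × (Q.EQ → E)} {i : ι}

theorem IsTypedMono.isMatch {fv : Q.NQ ⊕ Q.EQ → MVNode N E ι}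
    {fe : Q.EQ ⊕ Q.EQ → MVEdge N E ι}
    (h : IsTypedMono Q.transMV (V.comb tyN tyEg) fv fe) (hc : Corr Q fv m)
    (hp : ∀ v, i ∈ V.pOf (fv v)) :
    IsMatch src tgt tyN tyEg Q (V.projPG i) m.1 m.2 := by
  obtain ⟨hv, -, -, -, hs, ht, htv, hte⟩ := h
  obtain ⟨cv, ce⟩ := hc
  refine ⟨fun a b hab => ?_, fun a b hab => ?_, fun e => ?_, fun e => ?_, fun v => ?_,
    fun e => ?_, fun v => ?_, fun e => ?_⟩
  · exact Sum.inl_injective (hv (by rw [cv, cv, hab]))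
  · exact Sum.inr_injective (hv (by rw [ce, ce, hab]))
  · exact V.comb_edge_src (hte (Sum.inl e)) ((hs (Sum.inl e)).trans (ce e))
      ((ht (Sum.inl e)).trans (cv _))
  · exact V.comb_edge_tgt (hte (Sum.inr e)) ((hs (Sum.inr e)).trans (ce e))
      ((ht (Sum.inr e)).trans (cv _))
  · have := htv (Sum.inl v)
    rw [cv] at this
    exact Sum.inl_injective (Sum.inl_injective this)
  · have := htv (Sum.inr e)
    rw [ce] at this
    exact Sum.inr_injective (Sum.inl_injective this)
  · have := hp (Sum.inl v)
    rwa [cv] at this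
  · have := hp (Sum.inr e)
    rwa [ce] at this

theorem IsMatch.isTypedMono (h : IsMatch src tgt tyN tyEg Q (V.projPG i) m.1 m.2) :
    IsTypedMono Q.transMV (V.comb tyN tyEg)
      (fun x => Sum.inl (Sum.map m.1 m.2 x)) (fun x => Sum.inl (Sum.map m.2 m.2 x)) := by
  have hV (v : Q.NQ) : m.1 v ∈ V.unionPG.verts :=
    Set.mem_iUnion.2 (Versioning.mvPresent.exists_memEl (h.mem_v v))
  have hE (e : Q.EQ) : m.2 e ∈ V.unionPG.edges :=
    Set.mem_iUnion.2 (Versioning.mvPresent.exists_memEl (h.mem_e e))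
  refine ⟨Sum.inl_injective.comp (h.inj_v.sumMap h.inj_e),
    Sum.inl_injective.comp (h.inj_e.sumMap h.inj_e), ?_, ?_, ?_, ?_, ?_, ?_⟩
  · rintro (v | e) -
    exacts [hV v, hE e]
  · rintro (e | e) -
    exacts [hE e, hE e]
  · rintro (e | e) <;> rfl
  · rintro (e | e)
    · exact congrArg (fun n => Sum.inl (Sum.inl n)) (h.comm_src e)
    · exact congrArg (fun n => Sum.inl (Sum.inl n)) (h.comm_tgt e)
  · rintro (v | e)
    · exact congrArg (fun t => Sum.inl (Sum.inl t)) (h.ty_v v)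
    · exact congrArg (fun t => Sum.inl (Sum.inr t)) (h.ty_e e)
  · rintro (e | e)
    · exact congrArg (fun t => Sum.inl (Sum.inl t)) (h.ty_e e)
    · exact congrArg (fun t => Sum.inl (Sum.inr t)) (h.ty_e e)

end MatchTranslation

/-- The multi-version check computes exactly the violations
of all individual versions:
`pcheck_mv (MVM, φ) = ⨄_i {(i, m) | m ∈ pcheck (proj (MVM, i), φ)}`. -/
theorem pcheckMV_eq_union_pcheck_proj
    {N E TN TE ι : Type} (src tgt : E → N) (tyN : N → TN) (tyEg : E → TE)
    (V : Versioning N E src tgt ι) (Q : Pattern TN TE) :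
    pcheckMV src tgt tyN tyEg V Q =
      {p : ι × ((Q.NQ → N) × (Q.EQ → E)) |
        p.2 ∈ pcheck src tgt tyN tyEg Q (V.projPG p.1)} := by
  ext ⟨i, m⟩
  constructor
  · rintro ⟨fv, fe, h, hc, hp⟩
    exact h.isMatch hc hp
  · intro h
    refine ⟨_, _, IsMatch.isTypedMono h, ⟨fun _ => rfl, fun _ => rfl⟩, ?_⟩
    rintro (v | e)
    exacts [h.mem_v v, h.mem_e e]
end

section
/- For a correct model versioning Δ with union P^M = ⋃_i M_i and multi-version model MVM = comb(Δ), and a violation pattern Q typed over TM with translation Q_mv = trans_mv(Q) and bijections origin : trans_mv(P^M) → P^M and origin_Q : Q_mv → Q, the assignment m_mv ↦ origin ∘ m_mv ∘ origin_Q^{-1} is a bijection between the set of typed monomorphisms m_mv : Q_mv → MVM and the set of typed monomorphisms m : Q → P^M. -/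
section TranslatedMatches

variable {N E TN TE ι : Type}

/-- The node function `origin⁻¹ ∘ m ∘ origin_Q` of the translation of `m`. -/
def liftNode (ι : Type) (Q : Pattern TN TE) (m : (Q.NQ → N) × (Q.EQ → E)) :
    Q.NQ ⊕ Q.EQ → MVNode N E ι :=
  fun x => Sum.inl (Sum.map m.1 m.2 x)

/-- The edge function of the translation of `m`, mapping source- and
target-encoding edges to source- and target-encoding edges. -/
def liftEdge (ι : Type) (Q : Pattern TN TE) (m : (Q.NQ → N) × (Q.EQ → E)) :
    Q.EQ ⊕ Q.EQ → MVEdge N E ι :=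
  fun x => Sum.inl (Sum.map m.2 m.2 x)

theorem corr_iff_eq_liftNode {Q : Pattern TN TE} {fv : Q.NQ ⊕ Q.EQ → MVNode N E ι}
    {m : (Q.NQ → N) × (Q.EQ → E)} : Corr Q fv m ↔ fv = liftNode ι Q m := by
  rw [funext_iff, Sum.forall]
  rfl

theorem liftNode_injective (Q : Pattern TN TE) :
    Function.Injective (liftNode (N := N) (E := E) ι Q) := by
  rintro ⟨mv, me⟩ ⟨mv', me'⟩ h
  refine Prod.ext (funext fun v => ?_) (funext fun e => ?_)
  · simpa [liftNode] using congrFun h (Sum.inl v)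
  · simpa [liftNode] using congrFun h (Sum.inr e)

variable {src tgt : E → N} {tyN : N → TN} {tyEg : E → TE}
  {V : Versioning N E src tgt ι} {Q : Pattern TN TE}

theorem isTypedMono_lift_iff {m : (Q.NQ → N) × (Q.EQ → E)} :
    IsTypedMono Q.transMV (V.comb tyN tyEg) (liftNode ι Q m) (liftEdge ι Q m) ↔
      IsMatch src tgt tyN tyEg Q V.unionPG m.1 m.2 := by
  constructor
  · rintro ⟨hv, -, hV, -, -, ht, htv, -⟩
    have hinj : Function.Injective (Sum.map m.1 m.2) := fun _ _ h => hv (congrArg Sum.inl h)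
    rw [Sum.map_injective] at hinj
    exact
      { inj_v := hinj.1
        inj_e := hinj.2
        comm_src := fun e => Sum.inl_injective (Sum.inl_injective (ht (Sum.inl e)))
        comm_tgt := fun e => Sum.inl_injective (Sum.inl_injective (ht (Sum.inr e)))
        ty_v := fun v => Sum.inl_injective (Sum.inl_injective (htv (Sum.inl v)))
        ty_e := fun e => Sum.inr_injective (Sum.inl_injective (htv (Sum.inr e)))
        mem_v := fun v => hV (Sum.inl v) trivial
        mem_e := fun e => hV (Sum.inr e) trivial }
  · intro h
    refine ⟨Sum.inl_injective.comp (h.inj_v.sumMap h.inj_e),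
      Sum.inl_injective.comp (h.inj_e.sumMap h.inj_e), ?_, ?_, ?_, ?_, ?_, ?_⟩
    · rintro (v | e) -
      exacts [h.mem_v v, h.mem_e e]
    · rintro (e | e) -
      exacts [h.mem_e e, h.mem_e e]
    · rintro (e | e) <;> rfl
    · rintro (e | e)
      exacts [congrArg (Sum.inl ∘ Sum.inl) (h.comm_src e),
        congrArg (Sum.inl ∘ Sum.inl) (h.comm_tgt e)]
    · rintro (v | e)
      exacts [congrArg (Sum.inl ∘ Sum.inl) (h.ty_v v), congrArg (Sum.inl ∘ Sum.inr) (h.ty_e e)]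
    · rintro (e | e)
      exacts [congrArg (Sum.inl ∘ Sum.inl) (h.ty_e e), congrArg (Sum.inl ∘ Sum.inr) (h.ty_e e)]

theorem IsTypedMono.exists_eq_liftNode {fv : Q.NQ ⊕ Q.EQ → MVNode N E ι}
    {fe : Q.EQ ⊕ Q.EQ → MVEdge N E ι} (h : IsTypedMono Q.transMV (V.comb tyN tyEg) fv fe) :
    ∃ m, fv = liftNode ι Q m := by
  obtain ⟨-, -, -, -, -, -, hty, -⟩ := h
  have hv (v : Q.NQ) : ∃ n, fv (Sum.inl v) = Sum.inl (Sum.inl n) := by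
    have := hty (Sum.inl v)
    rcases hx : fv (Sum.inl v) with (n | e) | i <;> simp_all [Versioning.comb, Pattern.transMV]
  have he (e : Q.EQ) : ∃ e', fv (Sum.inr e) = Sum.inl (Sum.inr e') := by
    have := hty (Sum.inr e)
    rcases hx : fv (Sum.inr e) with (n | e') | i <;> simp_all [Versioning.comb, Pattern.transMV]
  choose mv hmv using hv
  choose me hme using he
  exact ⟨(mv, me), corr_iff_eq_liftNode.mp ⟨hmv, hme⟩⟩

/-- The node function of a typed monomorphism determines its edge function. -/
theorem IsTypedMono.eq_liftEdge {m : (Q.NQ → N) × (Q.EQ → E)}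
    {fe : Q.EQ ⊕ Q.EQ → MVEdge N E ι}
    (h : IsTypedMono Q.transMV (V.comb tyN tyEg) (liftNode ι Q m) fe) :
    fe = liftEdge ι Q m := by
  obtain ⟨-, -, -, -, hs, -, -, hty⟩ := h
  funext x
  have hsx := hs x
  have htx := hty x
  rcases x with e | e
  all_goals
    rcases hx : fe _ with (e' | e') | p | p | p <;> rw [hx] at hsx htx <;>
      simp_all [Versioning.comb, Pattern.transMV, liftNode, liftEdge]

end TranslatedMatches

/-- The assignment `m_mv ↦ origin ∘ m_mv ∘ origin_Q⁻¹`
(expressed by the relation `Corr`) is a bijection between the set of typed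
monomorphisms `m_mv : trans_mv Q → MVM` and the set of typed monomorphisms
`m : Q → P^M` into the union of all model versions. -/
theorem transMV_matches_bijective
    {N E TN TE ι : Type} (src tgt : E → N) (tyN : N → TN) (tyEg : E → TE)
    (V : Versioning N E src tgt ι) (Q : Pattern TN TE) :
    (∀ (fv : (Q.NQ ⊕ Q.EQ) → MVNode N E ι)
        (fe : (Q.EQ ⊕ Q.EQ) → MVEdge N E ι),
      IsTypedMono Q.transMV (V.comb tyN tyEg) fv fe →
      ∃! m : (Q.NQ → N) × (Q.EQ → E),
        IsMatch src tgt tyN tyEg Q V.unionPG m.1 m.2 ∧ Corr Q fv m) ∧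
    (∀ m : (Q.NQ → N) × (Q.EQ → E),
      IsMatch src tgt tyN tyEg Q V.unionPG m.1 m.2 →
      ∃! p : ((Q.NQ ⊕ Q.EQ) → MVNode N E ι) × ((Q.EQ ⊕ Q.EQ) → MVEdge N E ι),
        IsTypedMono Q.transMV (V.comb tyN tyEg) p.1 p.2 ∧ Corr Q p.1 m) := by
  refine ⟨fun fv fe h => ?_, fun m hm => ?_⟩
  · obtain ⟨m, rfl⟩ := h.exists_eq_liftNode
    obtain rfl := h.eq_liftEdge
    exact ⟨m, ⟨isTypedMono_lift_iff.mp h, corr_iff_eq_liftNode.mpr rfl⟩,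
      fun m' hm' => liftNode_injective Q (corr_iff_eq_liftNode.mp hm'.2).symm⟩
  · refine ⟨(liftNode ι Q m, liftEdge ι Q m),
      ⟨isTypedMono_lift_iff.mpr hm, corr_iff_eq_liftNode.mpr rfl⟩, ?_⟩
    rintro ⟨fv, fe⟩ ⟨h, hc⟩
    obtain rfl := corr_iff_eq_liftNode.mp hc
    exact Prod.ext rfl h.eq_liftEdge
end
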